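/- arXiv:2204.01170 — 2 statements merged into one kernel-verified Lean document; each statement's English description precedes it below -/
import Mathlib

section
/- Lemma 3.3(ii) (late-time super- and subsolutions for the inner expansion): Let i, k, ℓ be nonnegative integers with 3i + 4k ≥ ℓ, set p := 3i + 4k − ℓ + 3, and fix A > 0. Let Ω := ({T : −A < T < 0} × ℝ) \ Q and ∂*Q := [−1,0) × {−1, 1}. Suppose b, c, G : Ω → ℝ satisfy |b| + |c| ≤ A and |G| ≤ A·𝔇^(−(p+2)) on Ω. Then there exist a constant C > 0 and a smooth positive function W on ([−A,0) × ℝ) \ Q such that: W > A·𝔇⁻ᵖ on ({−A} × ℝ) ∪ ∂*Q; W ≤ C·𝔇⁻ᵖ on ([−A,0) × ℝ) \ Q; and pointwise on Ω, ∂_T W ≥ −𝔘·∂_X W − (i+1)·(∂_X 𝔘)·W + b·∂_X W + c·W + ∂_X² W + G, while −W satisfies the reversed inequality (i.e. W is a supersolution and −W a subsolution of ∂_T V = −𝔘·∂_X V − (i+1)(∂_X 𝔘)·V + b·∂_X V + c·V + ∂_X² V + G). -/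
open Set

/-- For `T < 0` the cubic `u ↦ T * u - β * u ^ 3` is injective. -/
theorem cubic_injective {β T : ℝ} (hβ : 0 < β) (hT : T < 0) {u v : ℝ}
    (h : T * u - β * u ^ 3 = T * v - β * v ^ 3) : u = v := by
  have h1 : (u - v) * (T - β * (u ^ 2 + u * v + v ^ 2)) = 0 := by linear_combination h
  rcases mul_eq_zero.1 h1 with h2 | h2
  · linarith
  · have : 0 ≤ u ^ 2 + u * v + v ^ 2 := by nlinarith [sq_nonneg (u + v), sq_nonneg u, sq_nonneg v]
    nlinarith [mul_nonneg hβ.le this]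

/-- The invertible differential of `(t, u) ↦ (t, t * u - β * u ^ 3)`. -/
noncomputable def shearEquiv (a d : ℝ) (hd : d ≠ 0) : (ℝ × ℝ) ≃L[ℝ] (ℝ × ℝ) :=
  ContinuousLinearEquiv.equivOfInverse
    ((ContinuousLinearMap.fst ℝ ℝ ℝ).prod
      (a • ContinuousLinearMap.fst ℝ ℝ ℝ + d • ContinuousLinearMap.snd ℝ ℝ ℝ))
    ((ContinuousLinearMap.fst ℝ ℝ ℝ).prod
      (d⁻¹ • (ContinuousLinearMap.snd ℝ ℝ ℝ - a • ContinuousLinearMap.fst ℝ ℝ ℝ)))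
    (fun p => by ext <;> simp [hd])
    (fun p => by ext <;> simp [hd])

theorem contDiffAt_cubicInverse {β : ℝ} (hβ : 0 < β) {U : ℝ → ℝ → ℝ}
    (hU : ∀ T : ℝ, T < 0 → ∀ X : ℝ, T * U T X - β * U T X ^ 3 = X)
    {T : ℝ} (hT : T < 0) (X : ℝ) :
    ContDiffAt ℝ (⊤ : ℕ∞) (fun p : ℝ × ℝ => U p.1 p.2) (T, X) := by
  set u := U T X with hu
  let F : ℝ × ℝ → ℝ × ℝ := fun p => (p.1, p.1 * p.2 - β * p.2 ^ 3)
  have hF : ContDiffAt ℝ (⊤ : ℕ∞) F (T, u) := by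
    apply ContDiff.contDiffAt
    fun_prop
  have hd : T - 3 * β * u ^ 2 ≠ 0 := by
    have : 0 ≤ β * u ^ 2 := by positivity
    linarith
  have hF' : HasFDerivAt F
      (shearEquiv u (T - 3 * β * u ^ 2) hd : (ℝ × ℝ) →L[ℝ] (ℝ × ℝ)) (T, u) := by
    have h1 : HasFDerivAt (fun p : ℝ × ℝ => p.1) (ContinuousLinearMap.fst ℝ ℝ ℝ) (T, u) :=
      hasFDerivAt_fst
    have h2 : HasFDerivAt (fun p : ℝ × ℝ => p.2) (ContinuousLinearMap.snd ℝ ℝ ℝ) (T, u) :=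
      hasFDerivAt_snd
    refine (h1.prodMk ((h1.mul h2).sub ((h2.pow 3).const_mul β))).congr_fderiv ?_
    ext <;> simp [shearEquiv, ContinuousLinearEquiv.equivOfInverse]
    ring
  have hne : ((⊤ : ℕ∞) : WithTop ℕ∞) ≠ 0 := by simp
  have hFT : F (T, u) = (T, X) := by simp [F, hu, hU T hT X]
  have hg := hF.to_localInverse hF' hne
  have hright := (hF.hasStrictFDerivAt' hF' hne).eventually_right_inverse
  rw [hFT] at hg hright
  have hneg : ∀ᶠ p : ℝ × ℝ in nhds (T, X), p.1 < 0 :=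
    continuous_fst.continuousAt.eventually_lt continuousAt_const hT
  refine (contDiffAt_snd.comp _ hg).congr_of_eventuallyEq ?_
  filter_upwards [hright, hneg] with p hp hpT
  have h1 := congrArg Prod.fst hp
  have h2 := congrArg Prod.snd hp
  simp only [F] at h1 h2
  rw [h1] at h2
  exact cubic_injective hβ hpT ((hU _ hpT _).trans h2.symm)

section Derivatives

variable {β : ℝ} {U : ℝ → ℝ → ℝ}

theorem cubicDenom_pos (hβ : 0 < β) {T : ℝ} (hT : T < 0) (u : ℝ) : 0 < -T + 3 * β * u ^ 2 := by
  have : 0 ≤ β * u ^ 2 := by positivity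
  linarith

theorem hasDerivAt_cubicInverse_right (hβ : 0 < β)
    (hU : ∀ T : ℝ, T < 0 → ∀ X : ℝ, T * U T X - β * U T X ^ 3 = X)
    {T : ℝ} (hT : T < 0) (X : ℝ) :
    HasDerivAt (fun Y => U T Y) (-(1 / (-T + 3 * β * U T X ^ 2))) X := by
  have hs : DifferentiableAt ℝ (fun Y => U T Y) X :=
    ((contDiffAt_cubicInverse hβ hU hT X).differentiableAt (by simp)).comp X
      (f := fun Y : ℝ => (T, Y)) (by fun_prop)
  have h1 := hs.hasDerivAt
  have h2 := (h1.const_mul T).sub ((h1.pow 3).const_mul β)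
  have h3 : HasDerivAt (fun Y : ℝ => Y) 1 X := hasDerivAt_id X
  have h4 := h2.unique (h3.congr_of_eventuallyEq (.of_forall fun Y => hU T hT Y))
  refine h1.congr_deriv (Eq.symm ?_)
  have hd := cubicDenom_pos hβ hT (U T X)
  rw [← neg_div, div_eq_iff hd.ne']
  push_cast at h4
  linear_combination h4

theorem hasDerivAt_cubicInverse_left (hβ : 0 < β)
    (hU : ∀ T : ℝ, T < 0 → ∀ X : ℝ, T * U T X - β * U T X ^ 3 = X)
    {T : ℝ} (hT : T < 0) (X : ℝ) :
    HasDerivAt (fun S => U S X) (U T X / (-T + 3 * β * U T X ^ 2)) T := by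
  have hs : DifferentiableAt ℝ (fun S => U S X) T :=
    ((contDiffAt_cubicInverse hβ hU hT X).differentiableAt (by simp)).comp T
      (f := fun S : ℝ => (S, X)) (by fun_prop)
  have h1 := hs.hasDerivAt
  have h2 := ((hasDerivAt_id T).mul h1).sub ((h1.pow 3).const_mul β)
  have h3 : HasDerivAt (fun _ : ℝ => X) 0 T := hasDerivAt_const T X
  have h4 := h2.unique (h3.congr_of_eventuallyEq (by
    filter_upwards [Iio_mem_nhds hT] with S hS using hU S hS X))
  refine h1.congr_deriv (Eq.symm ?_)
  have hd := cubicDenom_pos hβ hT (U T X)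
  rw [div_eq_iff hd.ne']
  push_cast at h4
  simp only [id] at h4
  linear_combination h4

end Derivatives

theorem hasDerivAt_inv_sqrt_one_add_sq_pow (p : ℕ) (u : ℝ) :
    HasDerivAt (fun u : ℝ => 1 / √(1 + u ^ 2) ^ p)
      (-(p * u / (1 + u ^ 2)) * (1 / √(1 + u ^ 2) ^ p)) u := by
  have hq : 0 < 1 + u ^ 2 := by positivity
  have hs : 0 < √(1 + u ^ 2) := Real.sqrt_pos.2 hq
  have h0 : HasDerivAt (fun u : ℝ => 1 + u ^ 2) (2 * u) u := by
    simpa using ((hasDerivAt_id u).pow 2).const_add 1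
  have h1 := ((h0.sqrt hq.ne').pow p).inv (pow_ne_zero p hs.ne')
  simp only [one_div]
  refine h1.congr_deriv ?_
  have hsq : √(1 + u ^ 2) ^ 2 = 1 + u ^ 2 := Real.sq_sqrt hq.le
  rcases p with _ | n
  · simp
  · simp only [Nat.add_sub_cancel, Pi.pow_apply]
    set s := √(1 + u ^ 2)
    rw [← hsq]
    field_simp
    ring

/-- The barrier `M * exp (lam * (T + B)) * (1 + U ^ 2) ^ (-p / 2)`. -/
noncomputable def barrier (U : ℝ → ℝ → ℝ) (M lam B : ℝ) (p : ℕ) (T X : ℝ) : ℝ :=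
  M * Real.exp (lam * (T + B)) * (1 / √(1 + U T X ^ 2) ^ p)

section Barrier

variable {β : ℝ} {U : ℝ → ℝ → ℝ}

theorem barrier_pos {M : ℝ} (hM : 0 < M) (lam B : ℝ) (p : ℕ) (T X : ℝ) :
    0 < barrier U M lam B p T X := by
  have : 0 < √(1 + U T X ^ 2) := Real.sqrt_pos.2 (by positivity)
  unfold barrier
  positivity

theorem contDiffAt_barrier (hβ : 0 < β)
    (hU : ∀ T : ℝ, T < 0 → ∀ X : ℝ, T * U T X - β * U T X ^ 3 = X)
    (M lam B : ℝ) (p : ℕ) {T : ℝ} (hT : T < 0) (X : ℝ) :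
    ContDiffAt ℝ (⊤ : ℕ∞) (fun z : ℝ × ℝ => barrier U M lam B p z.1 z.2) (T, X) := by
  have hq : 0 < 1 + U T X ^ 2 := by positivity
  have h := contDiffAt_cubicInverse hβ hU hT X
  have hs : ContDiffAt ℝ (⊤ : ℕ∞) (fun z : ℝ × ℝ => √(1 + U z.1 z.2 ^ 2)) (T, X) :=
    (contDiffAt_const.add (h.pow 2)).sqrt hq.ne'
  have he : ContDiffAt ℝ (⊤ : ℕ∞) (fun z : ℝ × ℝ => M * Real.exp (lam * (z.1 + B))) (T, X) := by
    fun_prop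
  exact he.mul (contDiffAt_const.div (hs.pow p) (pow_ne_zero p (Real.sqrt_pos.2 hq).ne'))

theorem hasDerivAt_barrier_right (hβ : 0 < β)
    (hU : ∀ T : ℝ, T < 0 → ∀ X : ℝ, T * U T X - β * U T X ^ 3 = X)
    (M lam B : ℝ) (p : ℕ) {T : ℝ} (hT : T < 0) (X : ℝ) :
    HasDerivAt (fun Y => barrier U M lam B p T Y)
      (p * U T X / ((1 + U T X ^ 2) * (-T + 3 * β * U T X ^ 2)) * barrier U M lam B p T X) X := by
  have h := ((hasDerivAt_inv_sqrt_one_add_sq_pow p (U T X)).comp X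
    (hasDerivAt_cubicInverse_right hβ hU hT X)).const_mul (M * Real.exp (lam * (T + B)))
  refine h.congr_deriv ?_
  have hd := cubicDenom_pos hβ hT (U T X)
  have hq : 0 < 1 + U T X ^ 2 := by positivity
  unfold barrier
  generalize 1 / √(1 + U T X ^ 2) ^ p = φ
  field_simp

theorem hasDerivAt_barrier_left (hβ : 0 < β)
    (hU : ∀ T : ℝ, T < 0 → ∀ X : ℝ, T * U T X - β * U T X ^ 3 = X)
    (M lam B : ℝ) (p : ℕ) {T : ℝ} (hT : T < 0) (X : ℝ) :
    HasDerivAt (fun S => barrier U M lam B p S X)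
      (lam * barrier U M lam B p T X - U T X * (p * U T X /
        ((1 + U T X ^ 2) * (-T + 3 * β * U T X ^ 2)) * barrier U M lam B p T X)) T := by
  have he : HasDerivAt (fun S => M * Real.exp (lam * (S + B)))
      (M * (Real.exp (lam * (T + B)) * (lam * 1))) T :=
    ((((hasDerivAt_id T).add_const B).const_mul lam).exp).const_mul M
  have h := he.mul ((hasDerivAt_inv_sqrt_one_add_sq_pow p (U T X)).comp T
    (hasDerivAt_cubicInverse_left hβ hU hT X))
  refine h.congr_deriv ?_
  have hd := cubicDenom_pos hβ hT (U T X)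
  have hq : 0 < 1 + U T X ^ 2 := by positivity
  unfold barrier
  simp only [Function.comp]
  generalize 1 / √(1 + U T X ^ 2) ^ p = φ
  field_simp
  ring

theorem hasDerivAt_barrier_logDeriv (hβ : 0 < β)
    (hU : ∀ T : ℝ, T < 0 → ∀ X : ℝ, T * U T X - β * U T X ^ 3 = X)
    (p : ℕ) {T : ℝ} (hT : T < 0) (X : ℝ) :
    HasDerivAt (fun Y => p * U T Y / ((1 + U T Y ^ 2) * (-T + 3 * β * U T Y ^ 2)))
      (p * (-(1 / ((1 + U T X ^ 2) * (-T + 3 * β * U T X ^ 2) ^ 2))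
        + 2 * U T X ^ 2 / ((1 + U T X ^ 2) ^ 2 * (-T + 3 * β * U T X ^ 2) ^ 2)
        + 6 * β * U T X ^ 2 / ((1 + U T X ^ 2) * (-T + 3 * β * U T X ^ 2) ^ 3))) X := by
  have h1 := hasDerivAt_cubicInverse_right hβ hU hT X
  have hd := cubicDenom_pos hβ hT (U T X)
  have hq : 0 < 1 + U T X ^ 2 := by positivity
  have h := (h1.const_mul (p : ℝ)).div
    (((h1.pow 2).const_add 1).mul (((h1.pow 2).const_mul (3 * β)).const_add (-T)))
    (mul_pos hq hd).ne'
  refine h.congr_deriv ?_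
  simp only [Pi.mul_apply, Pi.pow_apply]
  generalize U T X = u at *
  generalize hdd : -T + 3 * β * u ^ 2 = d at *
  generalize hqq : 1 + u ^ 2 = q at *
  field_simp
  push_cast
  ring

theorem abs_barrier_logDeriv_le {δ u d : ℝ} (p : ℕ) (hδ : 0 < δ) (hd : δ * (1 + u ^ 2) ≤ d) :
    |p * u / ((1 + u ^ 2) * d)| ≤ p / δ := by
  have hq : 1 ≤ 1 + u ^ 2 := by nlinarith [sq_nonneg u]
  have hdδ : δ ≤ d := by nlinarith
  have hd0 : 0 < d := by linarith
  rw [abs_div, abs_mul, Nat.abs_cast, abs_of_pos (a := (1 + u ^ 2) * d) (by positivity),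
    mul_div_assoc, div_eq_mul_one_div (p : ℝ) δ]
  refine mul_le_mul_of_nonneg_left ?_ p.cast_nonneg
  rw [div_le_div_iff₀ (by positivity) hδ]
  have : |u| ≤ 1 + u ^ 2 := by nlinarith [sq_nonneg (|u| - 1), sq_abs u]
  nlinarith [mul_le_mul this hdδ hδ.le (by positivity)]

theorem barrier_logDeriv_deriv_le {δ u d : ℝ} (p : ℕ) (hβ : 0 < β) (hδ : 0 < δ)
    (hd : δ * (1 + u ^ 2) ≤ d) :
    p * (-(1 / ((1 + u ^ 2) * d ^ 2)) + 2 * u ^ 2 / ((1 + u ^ 2) ^ 2 * d ^ 2)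
        + 6 * β * u ^ 2 / ((1 + u ^ 2) * d ^ 3)) ≤ p * (2 / δ ^ 2 + 6 * β / δ ^ 3) := by
  have hq : 1 ≤ 1 + u ^ 2 := by nlinarith [sq_nonneg u]
  have hdδ : δ ≤ d := by nlinarith
  have hd0 : 0 < d := by linarith
  have hu : u ^ 2 ≤ 1 + u ^ 2 := by linarith
  have h1 : 0 ≤ 1 / ((1 + u ^ 2) * d ^ 2) := by positivity
  have h2 : 2 * u ^ 2 / ((1 + u ^ 2) ^ 2 * d ^ 2) ≤ 2 / δ ^ 2 := by
    calc 2 * u ^ 2 / ((1 + u ^ 2) ^ 2 * d ^ 2)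
        ≤ 2 * (1 + u ^ 2) ^ 2 / ((1 + u ^ 2) ^ 2 * δ ^ 2) := by
          have := hu.trans (le_self_pow₀ hq two_ne_zero)
          gcongr
      _ = 2 / δ ^ 2 := by field_simp
  have h3 : 6 * β * u ^ 2 / ((1 + u ^ 2) * d ^ 3) ≤ 6 * β / δ ^ 3 := by
    calc 6 * β * u ^ 2 / ((1 + u ^ 2) * d ^ 3)
        ≤ 6 * β * (1 + u ^ 2) / ((1 + u ^ 2) * δ ^ 3) := by gcongr
      _ = 6 * β / δ ^ 3 := by field_simp
  gcongr
  linarith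

end Barrier

/-- Away from the unit box, and at times before `-a`, `|T| + 3 β U ^ 2` is bounded below by a multiple of `1 + U ^ 2`. -/
theorem exists_le_cubicDenom {β : ℝ} (hβ : 0 < β) {U : ℝ → ℝ → ℝ}
    (hU : ∀ T : ℝ, T < 0 → ∀ X : ℝ, T * U T X - β * U T X ^ 3 = X)
    {a : ℝ} (ha : 0 < a) :
    ∃ μ : ℝ, 0 < μ ∧ ∀ T X : ℝ, T < 0 →
      (T ≤ -a ∨ (T, X) ∉ Ioo (-1 : ℝ) 0 ×ˢ Ioo (-1 : ℝ) 1) →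
      μ ^ 2 * (1 + U T X ^ 2) ≤ -T + 3 * β * U T X ^ 2 := by
  set s : ℝ := 1 / (1 + β) with hs
  have hs0 : 0 < s := by positivity
  have hs1 : s ≤ 1 := by rw [hs, div_le_one (by positivity)]; linarith
  have hsβ : s * (1 + β) = 1 := by rw [hs]; field_simp
  set δ : ℝ := min (min 1 a) (β * s ^ 2) with hδ
  have hδ0 : 0 < δ := by positivity
  have hδ1 : δ ≤ min 1 a := min_le_left _ _
  have hδ2 : δ ≤ β * s ^ 2 := min_le_right _ _
  have hs2 : s ^ 2 ≤ 1 := by nlinarith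
  have hδ3 : δ ≤ 3 * β := by nlinarith
  refine ⟨√δ, Real.sqrt_pos.2 hδ0, fun T X hT hX => ?_⟩
  rw [Real.sq_sqrt hδ0.le]
  have h := hU T hT X
  generalize U T X = u at *
  have hu2 := sq_nonneg u
  by_cases hTa : T ≤ -min 1 a
  · nlinarith
  have hT1 : -1 < T := by linarith [not_le.1 hTa, min_le_left 1 a]
  replace hX := hX.resolve_left fun h' => hTa (by linarith [min_le_right 1 a])
  have hX1 : 1 ≤ |X| := by
    by_contra! hlt
    exact hX ⟨⟨hT1, hT⟩, abs_lt.1 hlt⟩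
  have hus : s ≤ |u| := by
    by_contra! hlt
    have h0 := abs_nonneg u
    have hX2 : |X| ≤ |u| * (1 + β) := by
      calc |X| = |T * u - β * u ^ 3| := by rw [h]
        _ ≤ |T * u| + |β * u ^ 3| := abs_sub _ _
        _ = |T| * |u| + β * |u| ^ 3 := by rw [abs_mul, abs_mul, abs_pow, abs_of_pos hβ]
        _ ≤ 1 * |u| + β * |u| := by
          gcongr
          · rw [abs_of_neg hT]; linarith
          · exact pow_le_of_le_one h0 (by linarith) (by norm_num)
        _ = |u| * (1 + β) := by ring
    nlinarith
  have hus2 : s ^ 2 ≤ u ^ 2 := by rw [← sq_abs u]; gcongr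
  nlinarith [mul_le_mul_of_nonneg_left hus2 hβ.le]

/-- Lemma 3.3(ii): late-time super- and subsolutions for the inner expansion. -/
theorem statement17
    (β₃ : ℝ) (hβ₃ : 0 < β₃)
    (UU DD : ℝ → ℝ → ℝ)
    (hUU : ∀ T : ℝ, T < 0 → ∀ X : ℝ, T * UU T X - β₃ * UU T X ^ 3 = X)
    (hDD : ∀ T X : ℝ, DD T X = Real.sqrt (|T| + 3 * β₃ * UU T X ^ 2))
    (i k ℓ : ℕ) (hikl : ℓ ≤ 3 * i + 4 * k)
    (A : ℝ) (hA : 0 < A)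
    (b c G : ℝ → ℝ → ℝ)
    (hbc : ∀ T X : ℝ,
      (T, X) ∈ (Set.Ioo (-A) (0:ℝ) ×ˢ (Set.univ : Set ℝ))
          \ (Set.Ioo (-1:ℝ) 0 ×ˢ Set.Ioo (-1:ℝ) 1) →
      |b T X| + |c T X| ≤ A)
    (hG : ∀ T X : ℝ,
      (T, X) ∈ (Set.Ioo (-A) (0:ℝ) ×ˢ (Set.univ : Set ℝ))
          \ (Set.Ioo (-1:ℝ) 0 ×ˢ Set.Ioo (-1:ℝ) 1) →
      |G T X| ≤ A / DD T X ^ (3 * i + 4 * k - ℓ + 5)) :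
    ∃ C : ℝ, 0 < C ∧ ∃ W : ℝ → ℝ → ℝ,
      ContDiffOn ℝ (⊤ : ℕ∞) (fun p : ℝ × ℝ => W p.1 p.2)
        ((Set.Ico (-A) (0:ℝ) ×ˢ (Set.univ : Set ℝ))
          \ (Set.Ioo (-1:ℝ) 0 ×ˢ Set.Ioo (-1:ℝ) 1)) ∧
      (∀ T X : ℝ,
        (T, X) ∈ (Set.Ico (-A) (0:ℝ) ×ˢ (Set.univ : Set ℝ))
            \ (Set.Ioo (-1:ℝ) 0 ×ˢ Set.Ioo (-1:ℝ) 1) →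
        0 < W T X ∧ W T X ≤ C / DD T X ^ (3 * i + 4 * k - ℓ + 3)) ∧
      (∀ X : ℝ, A / DD (-A) X ^ (3 * i + 4 * k - ℓ + 3) < W (-A) X) ∧
      (∀ T ∈ Set.Ico (-1:ℝ) 0,
        A / DD T (-1) ^ (3 * i + 4 * k - ℓ + 3) < W T (-1) ∧
        A / DD T 1 ^ (3 * i + 4 * k - ℓ + 3) < W T 1) ∧
      (∀ T X : ℝ,
        (T, X) ∈ (Set.Ioo (-A) (0:ℝ) ×ˢ (Set.univ : Set ℝ))
            \ (Set.Ioo (-1:ℝ) 0 ×ˢ Set.Ioo (-1:ℝ) 1) →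
        deriv (fun S => W S X) T ≥
          -(UU T X) * deriv (fun Y => W T Y) X
          - ((i : ℝ) + 1) * deriv (fun Y => UU T Y) X * W T X
          + b T X * deriv (fun Y => W T Y) X
          + c T X * W T X
          + deriv (deriv (fun Y => W T Y)) X + G T X) ∧
      (∀ T X : ℝ,
        (T, X) ∈ (Set.Ioo (-A) (0:ℝ) ×ˢ (Set.univ : Set ℝ))
            \ (Set.Ioo (-1:ℝ) 0 ×ˢ Set.Ioo (-1:ℝ) 1) →
        deriv (fun S => -W S X) T ≤
          -(UU T X) * deriv (fun Y => -W T Y) X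
          - ((i : ℝ) + 1) * deriv (fun Y => UU T Y) X * (-W T X)
          + b T X * deriv (fun Y => -W T Y) X
          + c T X * (-W T X)
          + deriv (deriv (fun Y => -W T Y)) X + G T X) := by
  have hDsq : ∀ T X : ℝ, T < 0 → DD T X = √(-T + 3 * β₃ * UU T X ^ 2) := fun T X hT => by
    rw [hDD, abs_of_neg hT]
  obtain ⟨μ, hμ, hlow⟩ := exists_le_cubicDenom hβ₃ hUU hA
  set E : ℝ → ℝ → ℝ := fun T X => √(1 + UU T X ^ 2) with hE
  have hE1 : ∀ T X, 1 ≤ E T X := fun T X => by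
    rw [hE, Real.one_le_sqrt]
    nlinarith [sq_nonneg (UU T X)]
  have hE0 : ∀ T X, 0 < E T X := fun T X => one_pos.trans_le (hE1 T X)
  have hDlow : ∀ T X : ℝ, T < 0 →
      (T ≤ -A ∨ (T, X) ∉ Ioo (-1 : ℝ) 0 ×ˢ Ioo (-1 : ℝ) 1) →
      μ * E T X ≤ DD T X := fun T X hT hX => by
    rw [hDsq T X hT]
    refine Real.le_sqrt_of_sq_le ?_
    rw [mul_pow, hE, Real.sq_sqrt (by positivity)]
    exact hlow T X hT hX
  set K : ℝ := √(A + 1 + 3 * β₃) with hK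
  have hDup : ∀ T X : ℝ, -A ≤ T → T < 0 → DD T X ≤ K * E T X := fun T X hAT hT => by
    rw [hDsq T X hT, hK, hE, ← Real.sqrt_mul (by positivity)]
    refine Real.sqrt_le_sqrt ?_
    nlinarith [sq_nonneg (UU T X)]
  have hbound : ∀ (n : ℕ) (T X : ℝ), T < 0 →
      (T ≤ -A ∨ (T, X) ∉ Ioo (-1 : ℝ) 0 ×ˢ Ioo (-1 : ℝ) 1) →
      A / DD T X ^ n ≤ A / μ ^ n * (1 / E T X ^ n) := fun n T X hT hX => by
    have := hE0 T X
    calc A / DD T X ^ n ≤ A / (μ * E T X) ^ n := by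
          gcongr
          exact hDlow T X hT hX
      _ = A / μ ^ n * (1 / E T X ^ n) := by rw [mul_pow]; field_simp
  generalize hp : 3 * i + 4 * k - ℓ + 3 = p at *
  rw [show 3 * i + 4 * k - ℓ + 5 = p + 2 by omega] at hG
  set lam : ℝ := (i + 1) / μ ^ 2 + A * (p / μ ^ 2) + A
    + (p * (2 / (μ ^ 2) ^ 2 + 6 * β₃ / (μ ^ 2) ^ 3) + (p / μ ^ 2) ^ 2) + A / μ ^ (p + 2) with hlam
  have hlam0 : 0 ≤ lam := by positivity
  set M : ℝ := A / μ ^ p + 1 with hM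
  have hM1 : 1 ≤ M := by rw [hM, le_add_iff_nonneg_left]; positivity
  have hM0 : 0 < M := one_pos.trans_le hM1
  set W := barrier UU M lam (A + 1) p with hW
  have hWpos : ∀ T X, 0 < W T X := barrier_pos hM0 lam (A + 1) p
  have hWlow : ∀ T X, -(A + 1) ≤ T → M * (1 / E T X ^ p) ≤ W T X := fun T X hT => by
    have h1 : 1 ≤ Real.exp (lam * (T + (A + 1))) :=
      Real.one_le_exp (mul_nonneg hlam0 (by linarith))
    have := hE0 T X
    rw [hW, barrier]
    gcongr
    exact le_mul_of_one_le_right hM0.le h1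
  have hWbdry : ∀ T X : ℝ, -(A + 1) ≤ T → T < 0 →
      (T ≤ -A ∨ (T, X) ∉ Ioo (-1 : ℝ) 0 ×ˢ Ioo (-1 : ℝ) 1) →
      A / DD T X ^ p < W T X := fun T X hAT hT hX => by
    have := hE0 T X
    calc A / DD T X ^ p ≤ A / μ ^ p * (1 / E T X ^ p) := hbound p T X hT hX
      _ < M * (1 / E T X ^ p) := by gcongr; linarith
      _ ≤ W T X := hWlow T X hAT
  have key : ∀ T X : ℝ, (T, X) ∈ (Ioo (-A) (0:ℝ) ×ˢ (univ : Set ℝ))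
        \ (Ioo (-1:ℝ) 0 ×ˢ Ioo (-1:ℝ) 1) → ∃ Wx Wxx : ℝ,
      deriv (fun Y => W T Y) X = Wx ∧ deriv (deriv (fun Y => W T Y)) X = Wxx ∧
      deriv (fun S => W S X) T = lam * W T X - UU T X * Wx ∧
      -((i : ℝ) + 1) * deriv (fun Y => UU T Y) X * W T X
        + b T X * Wx + c T X * W T X + Wxx + |G T X| ≤ lam * W T X := fun T X hTX => by
    obtain ⟨⟨⟨hAT, hT⟩, -⟩, hX⟩ := id hTX
    have hWx : ∀ Y, HasDerivAt (fun Y => W T Y) _ Y :=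
      fun Y => hasDerivAt_barrier_right hβ₃ hUU M lam (A + 1) p hT Y
    have hderiv := funext fun Y => (hWx Y).deriv
    have hWxx := (hasDerivAt_barrier_logDeriv hβ₃ hUU p hT X).mul (hWx X)
    refine ⟨_, _, (hWx X).deriv, (congrArg (fun f => deriv f X) hderiv).trans hWxx.deriv,
      (hasDerivAt_barrier_left hβ₃ hUU M lam (A + 1) p hT X).deriv, ?_⟩
    rw [(hasDerivAt_cubicInverse_right hβ₃ hUU hT X).deriv]
    have hd := hlow T X hT (.inr hX)
    have hμ2 : 0 < μ ^ 2 := by positivity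
    have hr := abs_barrier_logDeriv_le p hμ2 hd
    have hr' := barrier_logDeriv_deriv_le p hβ₃ hμ2 hd
    have hdμ : μ ^ 2 ≤ -T + 3 * β₃ * UU T X ^ 2 :=
      (le_mul_of_one_le_right hμ2.le (by nlinarith [sq_nonneg (UU T X)])).trans hd
    have hGW : |G T X| ≤ A / μ ^ (p + 2) * W T X := by
      refine (hG T X hTX).trans ((hbound (p + 2) T X hT (.inr hX)).trans ?_)
      have h0 := hE0 T X
      have h1 : 1 / E T X ^ (p + 2) ≤ 1 / E T X ^ p := by
        gcongr
        · exact hE1 T X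
        · omega
      have h2 : 1 / E T X ^ p ≤ W T X :=
        (le_mul_of_one_le_left (by positivity) hM1).trans (hWlow T X (by linarith))
      gcongr
      exact h1.trans h2
    have hW0 := hWpos T X
    have hbcT := hbc T X hTX
    have hb : |b T X| ≤ A := by linarith [abs_nonneg (c T X)]
    have hc : c T X ≤ A := by linarith [abs_nonneg (b T X), le_abs_self (c T X)]
    have hdi : ((i : ℝ) + 1) * (1 / (-T + 3 * β₃ * UU T X ^ 2)) ≤ (i + 1) / μ ^ 2 := by
      rw [mul_one_div]
      gcongr
    generalize p * (-(1 / ((1 + UU T X ^ 2) * (-T + 3 * β₃ * UU T X ^ 2) ^ 2))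
        + 2 * UU T X ^ 2 / ((1 + UU T X ^ 2) ^ 2 * (-T + 3 * β₃ * UU T X ^ 2) ^ 2)
        + 6 * β₃ * UU T X ^ 2 / ((1 + UU T X ^ 2) * (-T + 3 * β₃ * UU T X ^ 2) ^ 3)) = r' at *
    generalize p * UU T X / ((1 + UU T X ^ 2) * (-T + 3 * β₃ * UU T X ^ 2)) = r at *
    have hbr : b T X * r ≤ A * (p / μ ^ 2) :=
      (le_abs_self _).trans ((abs_mul _ _).trans_le (mul_le_mul hb hr (abs_nonneg _) hA.le))
    have hrr : r ^ 2 ≤ (p / μ ^ 2) ^ 2 := by rw [← sq_abs r]; gcongr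
    change _ + b T X * (r * W T X) + _ + (r' * W T X + r * (r * W T X)) + _ ≤ _
    have hsum : ((i : ℝ) + 1) * (1 / (-T + 3 * β₃ * UU T X ^ 2)) + b T X * r + c T X
        + (r' + r ^ 2) + A / μ ^ (p + 2) ≤ lam := by
      rw [hlam]
      linarith
    have := mul_le_mul_of_nonneg_right hsum hW0.le
    linarith
  refine ⟨M * Real.exp (lam * (A + 1)) * K ^ p, by positivity, W, ?_, ?_, ?_, ?_, ?_, ?_⟩
  · rintro ⟨T, X⟩ ⟨⟨⟨-, hT⟩, -⟩, -⟩
    exact (contDiffAt_barrier hβ₃ hUU M lam (A + 1) p hT X).contDiffWithinAt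
  · rintro T X ⟨⟨⟨hAT, hT⟩, -⟩, hX⟩
    refine ⟨hWpos T X, ?_⟩
    have h0 := hE0 T X
    have hD0 : 0 < DD T X := (by positivity : 0 < μ * E T X).trans_le (hDlow T X hT (.inr hX))
    have hE' : 1 / E T X ^ p ≤ K ^ p / DD T X ^ p := by
      rw [div_le_div_iff₀ (by positivity) (by positivity), one_mul, ← mul_pow]
      gcongr
      exact hDup T X hAT hT
    have hexp : Real.exp (lam * (T + (A + 1))) ≤ Real.exp (lam * (A + 1)) :=
      Real.exp_le_exp.2 (mul_le_mul_of_nonneg_left (add_le_of_nonpos_left hT.le) hlam0)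
    rw [mul_div_assoc, hW, barrier]
    gcongr
  · exact fun X => hWbdry (-A) X (by linarith) (by linarith) (.inl le_rfl)
  · rintro T ⟨hT1, hT⟩
    exact ⟨hWbdry T (-1) (by linarith) hT (.inr (by simp)), hWbdry T 1 (by linarith) hT (.inr (by simp))⟩
  · intro T X hTX
    obtain ⟨Wx, Wxx, h1, h2, h3, h4⟩ := key T X hTX
    rw [h1, h2, h3]
    linarith [le_abs_self (G T X)]
  · intro T X hTX
    obtain ⟨Wx, Wxx, h1, h2, h3, h4⟩ := key T X hTX
    have hneg : deriv (fun Y => -W T Y) = fun Y => -deriv (fun Y => W T Y) Y :=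
      funext fun Y => deriv.fun_neg
    simp only [hneg, deriv.fun_neg, h1, h2, h3]
    linarith [neg_abs_le (G T X)]
end

section
/- Lemma 4.3, first energy estimate: For every η ∈ [0,1) and every 𝔱 ∈ (t₀,0): ‖v‖²_{L²ₓ}(𝔱) ≤ (∫_{t₀}^{𝔱} ∫_ℝ |t|^η·E(t,x)² dx dt) · exp( ∫_{t₀}^{𝔱} ( ‖∂ₓu_app‖_{L∞ₓ}(t) + |t|^(−η) ) dt ). -/
open Set MeasureTheory Filter Topology

/-- A Grönwall inequality whose coefficient is only lower semicontinuous. -/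
theorem le_integral_mul_exp_of_hasDerivAt_le {G G' a b : ℝ → ℝ} {α β : ℝ} (hαβ : α < β)
    (hGc : ContinuousOn G (Icc α β)) (hG : ∀ t ∈ Ioo α β, HasDerivAt G (G' t) t)
    (hG0 : ∀ t ∈ Icc α β, 0 ≤ G t) (hGα : G α = 0)
    (ha : ∀ t ∈ Ioo α β, LowerSemicontinuousAt a t) (ha0 : ∀ t ∈ Icc α β, 0 ≤ a t)
    (hai : IntervalIntegrable a volume α β)
    (hb : ContinuousOn b (Icc α β)) (hb0 : ∀ t ∈ Icc α β, 0 ≤ b t)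
    (h : ∀ t ∈ Ioo α β, G' t ≤ a t * G t + b t) :
    G β ≤ (∫ t in α..β, b t) * Real.exp (∫ t in α..β, a t) := by
  set A : ℝ → ℝ := fun t => ∫ s in α..t, a s with hA
  set B : ℝ → ℝ := fun t => ∫ s in α..t, b s with hB
  have hu : uIcc α β = Icc α β := uIcc_of_le hαβ.le
  have hbi : IntervalIntegrable b volume α β := by
    apply ContinuousOn.intervalIntegrable; rwa [hu]
  have hsub : ∀ {f : ℝ → ℝ}, IntervalIntegrable f volume α β → ∀ s ∈ Icc α β, ∀ t ∈ Icc α β,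
      IntervalIntegrable f volume s t := by
    intro f hf s hs t ht
    apply hf.mono_set
    rw [hu]
    exact uIcc_subset_Icc hs ht
  have hprim : ∀ {f : ℝ → ℝ}, IntervalIntegrable f volume α β →
      ContinuousOn (fun t => ∫ s in α..t, f s) (Icc α β) := by
    intro f hf
    rw [← hu]
    apply intervalIntegral.continuousOn_primitive_interval
    rw [hu, integrableOn_Icc_iff_integrableOn_Ioc]
    exact (intervalIntegrable_iff_integrableOn_Ioc_of_le hαβ.le).1 hf
  have hAc : ContinuousOn A (Icc α β) := hprim hai
  have hBc : ContinuousOn B (Icc α β) := hprim hbi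
  have hA0 : ∀ t ∈ Icc α β, 0 ≤ A t := fun t ht =>
    intervalIntegral.integral_nonneg ht.1 fun s hs => ha0 s ⟨hs.1, hs.2.trans ht.2⟩
  set H : ℝ → ℝ := fun t => Real.exp (-A t) * G t - B t with hH
  have hHc : ContinuousOn H (Icc α β) :=
    ((Real.continuous_exp.comp_continuousOn hAc.neg).mul hGc).sub hBc
  have key : ∀ s ∈ Ioo α β, H β ≤ H s := by
    intro s hs
    refine image_le_of_liminf_slope_right_le_deriv_boundary (f := H) (a := s) (b := β)
      (B := fun _ => H s) (B' := fun _ => 0) (hHc.mono (Icc_subset_Icc_left hs.1.le)) le_rfl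
      continuousOn_const (fun x _ => hasDerivWithinAt_const _ _ _) ?_ ⟨hs.2.le, le_rfl⟩
    intro x hx r hr
    have hx' : x ∈ Ioo α β := ⟨hs.1.trans_le hx.1, hx.2⟩
    have hxI : x ∈ Icc α β := Ioo_subset_Icc_self hx'
    obtain ⟨ε, hε, hεr⟩ : ∃ ε > 0, ε * G x < r := by
      refine ⟨r / (G x + 1), div_pos hr (by linarith [hG0 x hxI]), ?_⟩
      rw [div_mul_eq_mul_div, div_lt_iff₀ (by linarith [hG0 x hxI])]
      nlinarith
    set K : ℝ → ℝ := fun z => Real.exp (-(A x + (a x - ε) * (z - x))) * G z - B z with hK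
    have hBd : HasDerivAt B (b x) x := by
      apply intervalIntegral.integral_hasDerivAt_right (hsub hbi _ ⟨le_rfl, hαβ.le⟩ _ hxI)
      · exact (hb.mono Ioo_subset_Icc_self).stronglyMeasurableAtFilter isOpen_Ioo x hx'
      · exact hb.continuousAt (Icc_mem_nhds hx'.1 hx'.2)
    have hKd : HasDerivAt K (Real.exp (-A x) * (G' x - (a x - ε) * G x) - b x) x := by
      have h1 : HasDerivAt (fun z => -(A x + (a x - ε) * (z - x))) (-((a x - ε) * 1)) x :=
        ((((hasDerivAt_id x).sub_const x).const_mul (a x - ε)).const_add (A x)).neg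
      refine ((h1.exp.mul (hG x hx')).sub hBd).congr_deriv ?_
      simp only [sub_self, mul_zero, add_zero]
      ring
    have hKlt : Real.exp (-A x) * (G' x - (a x - ε) * G x) - b x < r := by
      have he1 : Real.exp (-A x) ≤ 1 := Real.exp_le_one_iff.2 (by linarith [hA0 x hxI])
      have he0 := Real.exp_pos (-A x)
      have h2 : G' x - (a x - ε) * G x ≤ ε * G x + b x := by linarith [h x hx']
      have h3 : 0 ≤ ε * G x := mul_nonneg hε.le (hG0 x hxI)
      have h4 := mul_le_mul_of_nonneg_left h2 he0.le
      have h5 := mul_le_mul_of_nonneg_right he1 (add_nonneg h3 (hb0 x hxI))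
      linarith
    have hev : ∀ᶠ z in 𝓝[>] x, slope K x z < r :=
      (hKd.tendsto_slope.mono_left (nhdsWithin_mono _ fun z hz => ne_of_gt hz)).eventually_lt_const
        hKlt
    have hlsc : ∀ᶠ z in 𝓝 x, a x - ε < a z := ha x hx' _ (by linarith)
    obtain ⟨δ, hδ, hδa⟩ := Metric.eventually_nhds_iff.1 hlsc
    apply Eventually.frequently
    filter_upwards [hev, Ioo_mem_nhdsGT (lt_min hx.2 (lt_add_of_pos_right x hδ))] with z hz hzI
    refine lt_of_le_of_lt ?_ hz
    have hzβ : z < β := hzI.2.trans_le (min_le_left _ _)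
    have hzδ : z < x + δ := hzI.2.trans_le (min_le_right _ _)
    have hzI' : z ∈ Icc α β := ⟨(hx'.1.trans hzI.1).le, hzβ.le⟩
    have hAz : A x + (a x - ε) * (z - x) ≤ A z := by
      have h1 : A z - A x = ∫ s in x..z, a s :=
        intervalIntegral.integral_interval_sub_left (hsub hai _ ⟨le_rfl, hαβ.le⟩ _ hzI')
          (hsub hai _ ⟨le_rfl, hαβ.le⟩ _ hxI)
      have h2 : (∫ _ in x..z, (a x - ε)) ≤ ∫ s in x..z, a s := by
        refine intervalIntegral.integral_mono_on hzI.1.le intervalIntegrable_const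
          (hsub hai _ hxI _ hzI') fun s hs => (hδa ?_).le
        rw [Real.dist_eq, abs_of_nonneg (by linarith [hs.1])]
        linarith [hs.2]
      rw [intervalIntegral.integral_const, smul_eq_mul] at h2
      linarith
    have hHK : H z ≤ K z := by
      simp only [hH, hK]
      gcongr
      exact hG0 z hzI'
    have hHx : H x = K x := by simp [hH, hK]
    rw [slope_def_field, slope_def_field, hHx]
    have : 0 < z - x := sub_pos.2 hzI.1
    gcongr
  have hHα : H α = 0 := by simp [hH, hGα, hB]
  have hlim : Tendsto H (𝓝[>] α) (𝓝 (H α)) := by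
    have := (hHc α ⟨le_rfl, hαβ.le⟩).mono Ioo_subset_Icc_self
    rwa [ContinuousWithinAt, nhdsWithin_Ioo_eq_nhdsGT hαβ] at this
  have hfin : H β ≤ 0 := by
    rw [← hHα]
    refine ge_of_tendsto hlim ?_
    filter_upwards [Ioo_mem_nhdsGT hαβ] with s hs using key s hs
  have hfin' : Real.exp (-A β) * G β ≤ B β := by simpa [hH] using hfin
  calc G β = (Real.exp (-A β) * G β) * Real.exp (A β) := by
        rw [mul_right_comm, ← Real.exp_add]; simp
    _ ≤ B β * Real.exp (A β) := by gcongr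

theorem integral_energy_le {f f₁ f₂ u u₁ e : ℝ → ℝ} {ν M S c : ℝ} (hν : 0 ≤ ν) (hc : 0 < c)
    (hf : ∀ x, HasDerivAt f (f₁ x) x) (hf₁ : ∀ x, HasDerivAt f₁ (f₂ x) x)
    (hu : ∀ x, HasDerivAt u (u₁ x) x) (hf₂c : Continuous f₂) (hu₁c : Continuous u₁)
    (hec : Continuous e) (hfi : Integrable f) (hf₁i : Integrable f₁)
    (hfM : ∀ x, |f x| ≤ M) (hf₁M : ∀ x, |f₁ x| ≤ M) (hf₂M : ∀ x, |f₂ x| ≤ M)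
    (huM : ∀ x, |u x| ≤ M) (hu₁M : ∀ x, |u₁ x| ≤ M) (heM : ∀ x, |e x| ≤ M)
    (hei : Integrable e) (hS : ∀ x, |u₁ x| ≤ S) :
    ∫ x, 2 * f x * (-(u₁ x * f x + u x * f₁ x) - f x * f₁ x + ν * f₂ x + e x)
      ≤ (S + c⁻¹) * (∫ x, f x ^ 2) + ∫ x, c * e x ^ 2 := by
  have hfc : Continuous f := continuous_iff_continuousAt.2 fun x => (hf x).continuousAt
  have hf₁c : Continuous f₁ := continuous_iff_continuousAt.2 fun x => (hf₁ x).continuousAt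
  have huc : Continuous u := continuous_iff_continuousAt.2 fun x => (hu x).continuousAt
  have mul_i : ∀ {g k : ℝ → ℝ}, Continuous g → (∀ x, |g x| ≤ M) → Integrable k →
      Integrable fun x => g x * k x := fun hg hgM hk =>
    hk.bdd_mul hg.aestronglyMeasurable (Eventually.of_forall hgM)
  have hff := mul_i hfc hfM hfi
  have hee := mul_i hec heM hei
  have hfe := mul_i hec heM hfi
  have hff₁ := mul_i hf₁c hf₁M hfi
  have hff₂ := mul_i hf₂c hf₂M hfi
  have hf₁f₁ := mul_i hf₁c hf₁M hf₁i
  have huff := mul_i huc huM hff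
  have hu₁ff := mul_i hu₁c hu₁M hff
  have huff₁ := mul_i huc huM hff₁
  have hfff := mul_i hfc hfM hff
  have hfff₁ := mul_i hfc hfM hff₁
  set Φ : ℝ → ℝ := fun x => -(u x * (f x * f x)) - 2 / 3 * (f x * (f x * f x))
    + 2 * ν * (f₁ x * f x) with hΦ
  set Φ' : ℝ → ℝ := fun x => -(u₁ x * (f x * f x)) - 2 * (u x * (f₁ x * f x))
    - 2 * (f x * (f₁ x * f x)) + 2 * ν * (f₁ x * f₁ x) + 2 * ν * (f₂ x * f x) with hΦ'
  have hΦi : Integrable Φ := (huff.neg.sub (hfff.const_mul _)).add (hff₁.const_mul _)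
  have hΦ'i : Integrable Φ' := ((((hu₁ff.neg.sub (huff₁.const_mul _)).sub (hfff₁.const_mul _)).add
    (hf₁f₁.const_mul _)).add (hff₂.const_mul _))
  have hΦd : ∀ x, HasDerivAt Φ (Φ' x) x := by
    intro x
    have h2 := (hf x).mul (hf x)
    refine ((((hu x).mul h2).neg.sub (((hf x).mul h2).const_mul (2 / 3))).add
      (((hf₁ x).mul (hf x)).const_mul (2 * ν))).congr_deriv ?_
    simp only [hΦ', Pi.mul_apply]
    ring
  have h0 : ∫ x, Φ' x = 0 := integral_eq_zero_of_hasDerivAt_of_integrable hΦd hΦ'i hΦi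
  have hsq : Integrable fun x => f x ^ 2 := by simpa only [sq] using hff
  have hesq : Integrable fun x => e x ^ 2 := by simpa only [sq] using hee
  have hpt : ∀ x, 2 * f x * (-(u₁ x * f x + u x * f₁ x) - f x * f₁ x + ν * f₂ x + e x)
      = Φ' x + (-(u₁ x * (f x * f x)) - 2 * ν * (f₁ x * f₁ x) + 2 * (e x * f x)) := by
    intro x; simp only [hΦ']; ring
  simp_rw [hpt]
  have hri : Integrable fun x =>
      -(u₁ x * (f x * f x)) - 2 * ν * (f₁ x * f₁ x) + 2 * (e x * f x) :=
    (hu₁ff.neg.sub (hf₁f₁.const_mul _)).add (hfe.const_mul _)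
  rw [integral_add hΦ'i hri, h0, zero_add, ← integral_const_mul,
    ← integral_add (hsq.const_mul _) (hesq.const_mul _)]
  refine integral_mono hri ((hsq.const_mul _).add (hesq.const_mul _)) fun x => ?_
  have h1 : -(u₁ x) * f x ^ 2 ≤ S * f x ^ 2 :=
    mul_le_mul_of_nonneg_right ((neg_le_abs _).trans (hS x)) (sq_nonneg _)
  have h2 : 0 ≤ 2 * ν * (f₁ x * f₁ x) := mul_nonneg (by positivity) (mul_self_nonneg _)
  have h3 : 2 * (e x * f x) ≤ c⁻¹ * f x ^ 2 + c * e x ^ 2 := by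
    have h4 : 0 ≤ c⁻¹ * (f x - c * e x) ^ 2 := by positivity
    have h5 : c⁻¹ * (f x - c * e x) ^ 2 = c⁻¹ * f x ^ 2 + c * e x ^ 2 - 2 * (e x * f x) := by
      field_simp
      ring
    linarith
  show -(u₁ x * (f x * f x)) - 2 * ν * (f₁ x * f₁ x) + 2 * (e x * f x)
    ≤ (S + c⁻¹) * f x ^ 2 + c * e x ^ 2
  nlinarith

theorem abs_le_mul_inv_one_add_sq {y x M N : ℝ} (h₀ : |y| ≤ M) (h₂ : x ^ 2 * |y| ≤ N) :
    |y| ≤ (M + N) * (1 + x ^ 2)⁻¹ := by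
  rw [← div_eq_mul_inv, le_div_iff₀ (by positivity)]
  linarith

theorem aestronglyMeasurable_restrict_of_lowerSemicontinuousAt {a : ℝ → ℝ} {s : Set ℝ}
    (hs : MeasurableSet s) (ha : ∀ t ∈ s, LowerSemicontinuousAt a t) :
    AEStronglyMeasurable a (volume.restrict s) := by
  apply AEMeasurable.aestronglyMeasurable
  rw [aemeasurable_restrict_iff_comap_subtype hs]
  apply Measurable.aemeasurable
  apply LowerSemicontinuous.measurable
  intro t y hy
  exact continuous_subtype_val.continuousAt.eventually (ha t t.2 y hy)

section Slices

variable {w : ℝ → ℝ → ℝ} {t₀ t₁ t : ℝ}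

theorem contDiff_slice
    (hw : ContDiffOn ℝ (⊤ : ℕ∞) (fun p : ℝ × ℝ => w p.1 p.2) (Ico t₀ t₁ ×ˢ univ))
    (ht : t ∈ Ico t₀ t₁) : ContDiff ℝ (⊤ : ℕ∞) (w t) :=
  hw.comp_contDiff (contDiff_const.prodMk contDiff_id) fun _ => ⟨ht, mem_univ _⟩

theorem continuousOn_time
    (hw : ContDiffOn ℝ (⊤ : ℕ∞) (fun p : ℝ × ℝ => w p.1 p.2) (Ico t₀ t₁ ×ˢ univ)) (x : ℝ) :
    ContinuousOn (fun t => w t x) (Ico t₀ t₁) :=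
  hw.continuousOn.comp (by fun_prop : Continuous fun t : ℝ => (t, x)).continuousOn
    fun _ ht => ⟨ht, mem_univ _⟩

theorem contDiffAt_of_mem_Ioo
    (hw : ContDiffOn ℝ (⊤ : ℕ∞) (fun p : ℝ × ℝ => w p.1 p.2) (Ico t₀ t₁ ×ˢ univ))
    (ht : t ∈ Ioo t₀ t₁) (x : ℝ) :
    ContDiffAt ℝ (⊤ : ℕ∞) (fun p : ℝ × ℝ => w p.1 p.2) (t, x) :=
  hw.contDiffAt (prod_mem_nhds (Ico_mem_nhds ht.1 ht.2) univ_mem)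

theorem differentiableAt_time
    (hw : ContDiffOn ℝ (⊤ : ℕ∞) (fun p : ℝ × ℝ => w p.1 p.2) (Ico t₀ t₁ ×ˢ univ))
    (ht : t ∈ Ioo t₀ t₁) (x : ℝ) : DifferentiableAt ℝ (fun s => w s x) t :=
  ((contDiffAt_of_mem_Ioo hw ht x).differentiableAt (by simp)).comp t
    (f := fun s : ℝ => (s, x)) (by fun_prop)

theorem continuousAt_deriv_slice
    (hw : ContDiffOn ℝ (⊤ : ℕ∞) (fun p : ℝ × ℝ => w p.1 p.2) (Ico t₀ t₁ ×ˢ univ))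
    (ht : t ∈ Ioo t₀ t₁) (x : ℝ) : ContinuousAt (fun s => deriv (w s) x) t := by
  have hd : ∀ s ∈ Ioo t₀ t₁,
      fderiv ℝ (fun p : ℝ × ℝ => w p.1 p.2) (s, x) (0, 1) = deriv (w s) x := by
    intro s hs
    have h1 := ((contDiffAt_of_mem_Ioo hw hs x).differentiableAt (by simp)).hasFDerivAt
    have h2 : HasDerivAt (fun y : ℝ => (s, y)) ((0 : ℝ), (1 : ℝ)) x :=
      (hasDerivAt_const x s).prodMk (hasDerivAt_id x)
    exact (h1.comp_hasDerivAt x h2).deriv.symm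
  have hc : ContinuousAt
      (fun s : ℝ => fderiv ℝ (fun p : ℝ × ℝ => w p.1 p.2) (s, x) (0, 1)) t := by
    have h1 : ContinuousAt (fderiv ℝ (fun p : ℝ × ℝ => w p.1 p.2)) (t, x) :=
      ((contDiffAt_of_mem_Ioo hw ht x).fderiv_right (m := 0) (by simp)).continuousAt
    have h2 : ContinuousAt (fun s : ℝ => fderiv ℝ (fun p : ℝ × ℝ => w p.1 p.2) (s, x)) t :=
      ContinuousAt.comp (f := fun s : ℝ => (s, x)) h1 (by fun_prop)
    exact h2.clm_apply continuousAt_const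
  refine hc.congr ?_
  filter_upwards [Ioo_mem_nhds ht.1 ht.2] with s hs using hd s hs

end Slices

/-- Lemma 4.3, first energy estimate for the remainder `v = u^ν - u_app`. -/
theorem statement18
    (t₀ ν : ℝ) (ht₀ : t₀ < 0) (hν : 0 < ν)
    (uapp E v : ℝ → ℝ → ℝ)
    (huapp_smooth : ContDiffOn ℝ (⊤ : ℕ∞) (fun p : ℝ × ℝ => uapp p.1 p.2)
      (Set.Ico t₀ 0 ×ˢ (Set.univ : Set ℝ)))
    (hE_smooth : ContDiffOn ℝ (⊤ : ℕ∞) (fun p : ℝ × ℝ => E p.1 p.2)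
      (Set.Ico t₀ 0 ×ˢ (Set.univ : Set ℝ)))
    (hv_smooth : ContDiffOn ℝ (⊤ : ℕ∞) (fun p : ℝ × ℝ => v p.1 p.2)
      (Set.Ico t₀ 0 ×ˢ (Set.univ : Set ℝ)))
    (hv_schwartz : ∀ 𝔱 ∈ Set.Ioo t₀ (0:ℝ), ∀ kk nn : ℕ, ∃ M : ℝ,
      ∀ t ∈ Set.Icc t₀ 𝔱, ∀ x : ℝ, |x| ^ kk * |iteratedDeriv nn (v t) x| ≤ M)
    (hE_schwartz : ∀ 𝔱 ∈ Set.Ioo t₀ (0:ℝ), ∀ kk nn : ℕ, ∃ M : ℝ,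
      ∀ t ∈ Set.Icc t₀ 𝔱, ∀ x : ℝ, |x| ^ kk * |iteratedDeriv nn (E t) x| ≤ M)
    (huapp_bdd : ∀ 𝔱 ∈ Set.Ioo t₀ (0:ℝ), ∃ M : ℝ, ∀ t ∈ Set.Icc t₀ 𝔱, ∀ x : ℝ,
      |uapp t x| ≤ M ∧ |deriv (uapp t) x| ≤ M ∧ |deriv (deriv (uapp t)) x| ≤ M)
    (hpde : ∀ t ∈ Set.Ioo t₀ (0:ℝ), ∀ x : ℝ,
      deriv (fun s => v s x) t
        = -(deriv (fun y => uapp t y * v t y) x) - v t x * deriv (v t) x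
          + ν * deriv (deriv (v t)) x + E t x)
    (hinit : ∀ x : ℝ, v t₀ x = 0) :
    ∀ η : ℝ, 0 ≤ η → η < 1 → ∀ 𝔱 ∈ Set.Ioo t₀ (0:ℝ),
      (∫ x : ℝ, v 𝔱 x ^ 2)
        ≤ (∫ t in t₀..𝔱, ∫ x : ℝ, |t| ^ η * E t x ^ 2)
          * Real.exp (∫ t in t₀..𝔱,
              ((⨆ x : ℝ, |deriv (uapp t) x|) + |t| ^ (-η))) := by
  intro η _ _ 𝔱 h𝔱
  obtain ⟨M, hM⟩ : ∃ M : ℝ, ∀ t ∈ Icc t₀ 𝔱, ∀ x : ℝ,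
      (|v t x| ≤ M ∧ |deriv (v t) x| ≤ M ∧ |deriv (deriv (v t)) x| ≤ M) ∧
      (|uapp t x| ≤ M ∧ |deriv (uapp t) x| ≤ M) ∧ |E t x| ≤ M ∧
      |v t x| ≤ M * (1 + x ^ 2)⁻¹ ∧ |deriv (v t) x| ≤ M * (1 + x ^ 2)⁻¹ ∧
      |E t x| ≤ M * (1 + x ^ 2)⁻¹ := by
    obtain ⟨a₀, ha₀⟩ := hv_schwartz 𝔱 h𝔱 0 0
    obtain ⟨a₁, ha₁⟩ := hv_schwartz 𝔱 h𝔱 0 1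
    obtain ⟨a₂, ha₂⟩ := hv_schwartz 𝔱 h𝔱 0 2
    obtain ⟨b₀, hb₀⟩ := hv_schwartz 𝔱 h𝔱 2 0
    obtain ⟨b₁, hb₁⟩ := hv_schwartz 𝔱 h𝔱 2 1
    obtain ⟨c₀, hc₀⟩ := hE_schwartz 𝔱 h𝔱 0 0
    obtain ⟨c₂, hc₂⟩ := hE_schwartz 𝔱 h𝔱 2 0
    obtain ⟨d, hd⟩ := huapp_bdd 𝔱 h𝔱
    simp only [pow_zero, one_mul, iteratedDeriv_zero, sq_abs,
      iteratedDeriv_succ] at ha₀ ha₁ ha₂ hb₀ hb₁ hc₀ hc₂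
    refine ⟨|a₀| + |a₁| + |a₂| + |b₀| + |b₁| + |c₀| + |c₂| + |d|, fun t ht x => ?_⟩
    have e1 := le_abs_self a₀
    have e2 := le_abs_self a₁
    have e3 := le_abs_self a₂
    have e4 := le_abs_self b₀
    have e5 := le_abs_self b₁
    have e6 := le_abs_self c₀
    have e7 := le_abs_self c₂
    have e8 := le_abs_self d
    have p1 := abs_nonneg a₀
    have p2 := abs_nonneg a₁
    have p3 := abs_nonneg a₂
    have p4 := abs_nonneg b₀
    have p5 := abs_nonneg b₁
    have p6 := abs_nonneg c₀
    have p7 := abs_nonneg c₂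
    have p8 := abs_nonneg d
    have q : 0 ≤ (1 + x ^ 2)⁻¹ := by positivity
    have f1 := abs_le_mul_inv_one_add_sq (ha₀ t ht x) (hb₀ t ht x)
    have f2 := abs_le_mul_inv_one_add_sq (ha₁ t ht x) (hb₁ t ht x)
    have f3 := abs_le_mul_inv_one_add_sq (hc₀ t ht x) (hc₂ t ht x)
    obtain ⟨g1, g2, _⟩ := hd t ht x
    refine ⟨⟨(ha₀ t ht x).trans ?_, (ha₁ t ht x).trans ?_, (ha₂ t ht x).trans ?_⟩,
      ⟨g1.trans ?_, g2.trans ?_⟩, (hc₀ t ht x).trans ?_, f1.trans ?_, f2.trans ?_, f3.trans ?_⟩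
    any_goals apply mul_le_mul_of_nonneg_right _ q
    all_goals linarith
  have hlt : t₀ < 𝔱 := h𝔱.1
  have hM0 : 0 ≤ M := (abs_nonneg _).trans (hM 𝔱 ⟨hlt.le, le_rfl⟩ 0).1.1
  have hIco : Icc t₀ 𝔱 ⊆ Ico t₀ 0 := fun t ht => ⟨ht.1, ht.2.trans_lt h𝔱.2⟩
  have hIoo : Ioo t₀ 𝔱 ⊆ Ioo t₀ 0 := Ioo_subset_Ioo_right h𝔱.2.le
  have hdec : Integrable fun x : ℝ => M * (1 + x ^ 2)⁻¹ := integrable_inv_one_add_sq.const_mul M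
  have hint : ∀ {f : ℝ → ℝ}, Continuous f → (∀ x, |f x| ≤ M * (1 + x ^ 2)⁻¹) → Integrable f :=
    fun hf h => hdec.mono' hf.aestronglyMeasurable (Eventually.of_forall h)
  have vS := fun {t} (ht : t ∈ Icc t₀ 𝔱) => contDiff_slice hv_smooth (hIco ht)
  have uS := fun {t} (ht : t ∈ Icc t₀ 𝔱) => contDiff_slice huapp_smooth (hIco ht)
  have ES := fun {t} (ht : t ∈ Icc t₀ 𝔱) => contDiff_slice hE_smooth (hIco ht)
  have hderiv : ∀ {f : ℝ → ℝ}, ContDiff ℝ (⊤ : ℕ∞) f → ContDiff ℝ (⊤ : ℕ∞) (deriv f) :=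
    fun hf => (contDiff_infty_iff_deriv.1 hf).2
  have hD : ∀ {f : ℝ → ℝ}, ContDiff ℝ (⊤ : ℕ∞) f → ∀ x, HasDerivAt f (deriv f x) x :=
    fun hf x => (hf.differentiable (by simp) x).hasDerivAt
  have hsqc : ∀ {w : ℝ → ℝ → ℝ},
      ContDiffOn ℝ (⊤ : ℕ∞) (fun p : ℝ × ℝ => w p.1 p.2) (Ico t₀ 0 ×ˢ univ) →
      (∀ t ∈ Icc t₀ 𝔱, ∀ x, |w t x| ≤ M ∧ |w t x| ≤ M * (1 + x ^ 2)⁻¹) →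
      ContinuousOn (fun t => ∫ x, w t x ^ 2) (Icc t₀ 𝔱) := by
    intro w hw hwM
    refine continuousOn_of_dominated (bound := fun x => M * (M * (1 + x ^ 2)⁻¹)) (fun t ht => ?_)
      (fun t ht => Eventually.of_forall fun x => ?_) (hdec.const_mul M)
      (Eventually.of_forall fun x => ((continuousOn_time hw x).mono hIco).pow 2)
    · exact ((contDiff_slice hw (hIco ht)).continuous.pow 2).aestronglyMeasurable
    · rw [Real.norm_eq_abs, abs_pow, sq]
      exact mul_le_mul (hwM t ht x).1 (hwM t ht x).2 (abs_nonneg _) hM0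
  set R : ℝ → ℝ → ℝ := fun t x => -(deriv (uapp t) x * v t x + uapp t x * deriv (v t) x)
    - v t x * deriv (v t) x + ν * deriv (deriv (v t)) x + E t x with hR
  have hRc : ∀ t ∈ Icc t₀ 𝔱, Continuous (R t) := by
    intro t ht
    have c1 := (vS ht).continuous
    have c2 := (hderiv (vS ht)).continuous
    have c3 := (hderiv (hderiv (vS ht))).continuous
    have c4 := (uS ht).continuous
    have c5 := (hderiv (uS ht)).continuous
    have c6 := (ES ht).continuous
    fun_prop
  have hRM : ∀ t ∈ Icc t₀ 𝔱, ∀ x, |R t x| ≤ M * M + M * M + M * M + ν * M + M := by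
    intro t ht x
    obtain ⟨⟨h1, h2, h3⟩, ⟨h4, h5⟩, h6, _⟩ := hM t ht x
    have k1 : |deriv (uapp t) x * v t x| ≤ M * M := by
      rw [abs_mul]; exact mul_le_mul h5 h1 (abs_nonneg _) hM0
    have k2 : |uapp t x * deriv (v t) x| ≤ M * M := by
      rw [abs_mul]; exact mul_le_mul h4 h2 (abs_nonneg _) hM0
    have k3 : |v t x * deriv (v t) x| ≤ M * M := by
      rw [abs_mul]; exact mul_le_mul h1 h2 (abs_nonneg _) hM0
    have k4 : |ν * deriv (deriv (v t)) x| ≤ ν * M := by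
      rw [abs_mul, abs_of_pos hν]; exact mul_le_mul_of_nonneg_left h3 hν.le
    rw [abs_le] at *
    constructor <;> simp only [hR] <;> linarith [k1.1, k1.2, k2.1, k2.2, k3.1, k3.2, k4.1, k4.2]
  have hvt : ∀ t ∈ Ioo t₀ 𝔱, ∀ x, HasDerivAt (fun s => v s x) (R t x) t := by
    intro t ht x
    have htI := Ioo_subset_Icc_self ht
    have h1 := (differentiableAt_time hv_smooth (hIoo ht) x).hasDerivAt
    rw [hpde t (hIoo ht) x] at h1
    have h2 : deriv (fun y => uapp t y * v t y) x
        = deriv (uapp t) x * v t x + uapp t x * deriv (v t) x :=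
      ((hD (uS htI) x).mul (hD (vS htI) x)).deriv
    rwa [h2] at h1
  have hG : ∀ t ∈ Ioo t₀ 𝔱,
      HasDerivAt (fun s => ∫ x, v s x ^ 2) (∫ x, 2 * v t x * R t x) t := by
    intro t ht
    have htI := Ioo_subset_Icc_self ht
    refine (hasDerivAt_integral_of_dominated_loc_of_deriv_le
      (F' := fun t x => 2 * v t x * R t x) (s := Ioo t₀ 𝔱)
      (bound := fun x => 2 * (M * (1 + x ^ 2)⁻¹) * (M * M + M * M + M * M + ν * M + M))
      (Ioo_mem_nhds ht.1 ht.2) ?_ ?_ ?_ ?_ ((hdec.const_mul 2).mul_const _) ?_).2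
    · filter_upwards [Ioo_mem_nhds ht.1 ht.2] with s hs
      exact ((vS (Ioo_subset_Icc_self hs)).continuous.pow 2).aestronglyMeasurable
    · have h1 := (hint (vS htI).continuous fun x => (hM t htI x).2.2.2.1).bdd_mul
        (vS htI).continuous.aestronglyMeasurable (Eventually.of_forall fun x => (hM t htI x).1.1)
      simpa only [sq] using h1
    · exact ((continuous_const.mul (vS htI).continuous).mul (hRc t htI)).aestronglyMeasurable
    · refine Eventually.of_forall fun x s hs => ?_
      have hsI := Ioo_subset_Icc_self hs
      rw [Real.norm_eq_abs, abs_mul, abs_mul, abs_two]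
      have := (hM s hsI x).2.2.2.1
      have := hRM s hsI x
      gcongr
    · refine Eventually.of_forall fun x s hs => ((hvt s hs x).pow 2).congr_deriv ?_
      norm_num
  have hbdd : ∀ t ∈ Icc t₀ 𝔱, BddAbove (range fun x => |deriv (uapp t) x|) := by
    rintro t ht
    refine ⟨M, ?_⟩
    rintro _ ⟨x, rfl⟩
    exact (hM t ht x).2.1.2
  have hpow : ∀ r : ℝ, ContinuousOn (fun t : ℝ => |t| ^ r) (Icc t₀ 𝔱) := fun r =>
    continuous_abs.continuousOn.rpow_const fun t ht => Or.inl (abs_ne_zero.2 (hIco ht).2.ne)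
  have hsup : ∀ t ∈ Ioo t₀ 𝔱,
      LowerSemicontinuousAt (fun t => ⨆ x : ℝ, |deriv (uapp t) x|) t := by
    intro t ht
    refine lowerSemicontinuousAt_ciSup ?_ fun x =>
      (continuousAt_deriv_slice huapp_smooth (hIoo ht) x).abs.lowerSemicontinuousAt
    filter_upwards [Ioo_mem_nhds ht.1 ht.2] with s hs using hbdd s (Ioo_subset_Icc_self hs)
  have hsup0 : ∀ t, 0 ≤ ⨆ x : ℝ, |deriv (uapp t) x| := fun t =>
    Real.iSup_nonneg fun x => abs_nonneg _
  have hsupi : IntervalIntegrable (fun t => ⨆ x : ℝ, |deriv (uapp t) x|) volume t₀ 𝔱 := by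
    rw [intervalIntegrable_iff_integrableOn_Ioo_of_le hlt.le]
    refine IntegrableOn.of_bound (by simp)
      (aestronglyMeasurable_restrict_of_lowerSemicontinuousAt measurableSet_Ioo hsup) M ?_
    filter_upwards [ae_restrict_mem measurableSet_Ioo] with t ht
    rw [Real.norm_eq_abs, abs_of_nonneg (hsup0 t)]
    exact ciSup_le fun x => (hM t (Ioo_subset_Icc_self ht) x).2.1.2
  refine le_integral_mul_exp_of_hasDerivAt_le (G := fun t => ∫ x, v t x ^ 2)
    (G' := fun t => ∫ x, 2 * v t x * R t x) hlt
    (hsqc hv_smooth fun t ht x => ⟨(hM t ht x).1.1, (hM t ht x).2.2.2.1⟩) hG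
    (fun t _ => integral_nonneg fun x => sq_nonneg _) (by simp [hinit]) ?_ ?_ ?_ ?_ ?_ ?_
  · intro t ht
    exact (hsup t ht).add
      ((hpow (-η)).continuousAt (Icc_mem_nhds ht.1 ht.2)).lowerSemicontinuousAt
  · exact fun t _ => add_nonneg (hsup0 t) (by positivity)
  · refine hsupi.add (ContinuousOn.intervalIntegrable ?_)
    rw [uIcc_of_le hlt.le]
    exact hpow (-η)
  · simp_rw [integral_const_mul]
    exact (hpow η).mul (hsqc hE_smooth fun t ht x => ⟨(hM t ht x).2.2.1, (hM t ht x).2.2.2.2.2⟩)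
  · exact fun t _ => integral_nonneg fun x => by positivity
  · intro t ht
    have htI := Ioo_subset_Icc_self ht
    have htM := hM t htI
    simp only [Real.rpow_neg (abs_nonneg t)]
    exact integral_energy_le hν.le (Real.rpow_pos_of_pos (abs_pos.2 (hIoo ht).2.ne) η)
      (hD (vS htI)) (hD (hderiv (vS htI))) (hD (uS htI)) (hderiv (hderiv (vS htI))).continuous
      (hderiv (uS htI)).continuous (ES htI).continuous
      (hint (vS htI).continuous fun x => (htM x).2.2.2.1)
      (hint (hderiv (vS htI)).continuous fun x => (htM x).2.2.2.2.1)
      (fun x => (htM x).1.1) (fun x => (htM x).1.2.1) (fun x => (htM x).1.2.2)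
      (fun x => (htM x).2.1.1) (fun x => (htM x).2.1.2) (fun x => (htM x).2.2.1)
      (hint (ES htI).continuous fun x => (htM x).2.2.2.2.2) (le_ciSup (hbdd t htI))
end
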